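/- arXiv:1803.05433 — 2 statements merged into one kernel-verified Lean document; each statement's English description precedes it below -/
import Mathlib

section
/- Let μ be a p×p general closed interval matrix. Then μ is full-rank if and only if the following three conditions hold. (1) For every (i,j) with μ_{i,j} = (−∞, +∞): in the deleted matrix μ_{î,ĵ} there is no totally nonconstant partial generalized diagonal of length p−1, and the complementary matrix of every totally nonconstant partial generalized diagonal of μ_{î,ĵ} of length between 0 and p−2 has det^c equal to 0. (2) For every vertex matrix of μ̃-bar (i.e., of the real-endpoint closure: every vertex matrix of the matrix obtained from μ̃ by replacing half-bounded entries by their finite endpoints) of even type, the product of its determinant with det((μ̃)̄_l) is positive. (3) For every vertex matrix γ of μ̃ of even type and every choice of positions (i₁,j₁), …, (i_s,j_s) ∈ {1,…,p}×{1,…,p} with i₁,…,i_s distinct, j₁,…,j_s distinct, and μ_{i₁,j₁}, …, μ_{i_s,j_s} all half-bounded, one has (−1)^{i₁+j₁+ ĩ₂+ j̃₂ + … + ĩ_s + j̃_s + χ((i₁,j₁),…,(i_s,j_s))} · det((μ̃)̄_l) · det(γ̄_{î₁…î_s, ĵ₁…ĵ_s}) ≥ 0. -/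
open scoped Classical

/-- A real matrix `A` is contained in the (general closed interval) matrix `μ` of subsets
of `ℝ` iff each entry of `A` belongs to the corresponding entry of `μ`. -/
def Contains {I J : Type*} (μ : Matrix I J (Set ℝ)) (A : Matrix I J ℝ) : Prop :=
  ∀ i j, A i j ∈ μ i j

/-- `μ` is a general closed interval matrix: every entry is a closed connected nonempty
subset of `ℝ`. -/
def GCIM {I J : Type*} (μ : Matrix I J (Set ℝ)) : Prop :=
  ∀ i j, IsClosed (μ i j) ∧ (μ i j).Nonempty ∧ IsPreconnected (μ i j)

/-- An entry is constant iff it is a singleton. -/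
def IsConst (S : Set ℝ) : Prop := ∃ a : ℝ, S = {a}

/-- A bounded entry: a closed bounded interval `[a, b]` with `a ≤ b`. -/
def IsBddEntry (S : Set ℝ) : Prop := ∃ a b : ℝ, a ≤ b ∧ S = Set.Icc a b

/-- A left-bounded entry `[a, +∞)`. -/
def IsLeftB (S : Set ℝ) : Prop := ∃ a : ℝ, S = Set.Ici a

/-- A right-bounded entry `(-∞, a]`. -/
def IsRightB (S : Set ℝ) : Prop := ∃ a : ℝ, S = Set.Iic a

/-- `μ̃`: the matrix obtained from `μ` by replacing every entry equal to
`(-∞, +∞) = Set.univ` with the constant `{0}`. -/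
noncomputable def tildeM {I J : Type*} (μ : Matrix I J (Set ℝ)) : Matrix I J (Set ℝ) :=
  Matrix.of fun i j => if μ i j = Set.univ then ({0} : Set ℝ) else μ i j

/-- `ρ̄`: the matrix obtained from `ρ` by replacing every half-bounded entry `[a, +∞)` or
`(-∞, b]` by the singleton of its finite endpoint. -/
noncomputable def barM {I J : Type*} (ρ : Matrix I J (Set ℝ)) : Matrix I J (Set ℝ) :=
  Matrix.of fun i j =>
    if IsLeftB (ρ i j) then {sInf (ρ i j)}
    else if IsRightB (ρ i j) then {sSup (ρ i j)}
    else ρ i j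

/-- The real number associated to an entry which is a singleton, a bounded interval, or a
half-bounded interval: the left endpoint if the entry is bounded below (`{a} ↦ a`,
`[a,b] ↦ a`, `[a,+∞) ↦ a`) and otherwise the right endpoint (`(-∞,b] ↦ b`).  Applied
entrywise to a matrix `ρ` with no entry `(-∞,+∞)` this realizes the real matrix `ρ̄ₗ`;
applied to a matrix `γ` with constant or half-bounded entries it realizes `γ̄`. -/
noncomputable def pick (S : Set ℝ) : ℝ := if BddBelow S then sInf S else sSup S

/-- `γ` is a vertex matrix of `ν`: on bounded entries of `ν`, `γ` is the singleton of one
of the two endpoints; on all other entries `γ` coincides with `ν`. -/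
def IsVertex {I J : Type*} (ν γ : Matrix I J (Set ℝ)) : Prop :=
  ∀ i j, (IsBddEntry (ν i j) → (γ i j = {sInf (ν i j)} ∨ γ i j = {sSup (ν i j)})) ∧
         (¬ IsBddEntry (ν i j) → γ i j = ν i j)

/-- A vertex matrix `γ` of `ν` is of even type: for every `2 × 2` submatrix of `ν` all of
whose entries are bounded intervals, either some of its entries is constant, or the number
of the corresponding entries of `γ` equal to the left endpoint of the corresponding entry
of `ν` is even. -/
def EvenTypeG {I J : Type*} (ν γ : Matrix I J (Set ℝ)) : Prop :=
  ∀ i1 i2 j1 j2, i1 ≠ i2 → j1 ≠ j2 →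
    (IsBddEntry (ν i1 j1) ∧ IsBddEntry (ν i1 j2) ∧ IsBddEntry (ν i2 j1) ∧
      IsBddEntry (ν i2 j2)) →
    ((IsConst (ν i1 j1) ∨ IsConst (ν i1 j2) ∨ IsConst (ν i2 j1) ∨ IsConst (ν i2 j2)) ∨
     Even ((if γ i1 j1 = {sInf (ν i1 j1)} then 1 else 0) +
           (if γ i1 j2 = {sInf (ν i1 j2)} then 1 else 0) +
           (if γ i2 j1 = {sInf (ν i2 j1)} then 1 else 0) +
           (if γ i2 j2 = {sInf (ν i2 j2)} then (1 : ℕ) else 0)))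

/-- `det^c` of a square matrix of subsets of `ℝ`: the sum over all (generalized)
permutations all of whose selected entries are constant, of the sign of the permutation
times the product of the constants (a singleton `{a}` has `sSup {a} = a`).  Rows and
columns are identified with `Fin n` via the unique monotone bijections. -/
noncomputable def detc {I J : Type*} [Fintype I] [Fintype J] [LinearOrder I] [LinearOrder J]
    (ν : Matrix I J (Set ℝ)) : ℝ :=
  ∑ e : I ≃ J,
    if ∀ i, IsConst (ν i (e i)) then
      ((Equiv.Perm.sign ((monoEquivOfFin I rfl).toEquiv.trans
        (e.trans (monoEquivOfFin J (Fintype.card_congr e.symm)).toEquiv.symm)) : ℤ) : ℝ) *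
      ∏ i, sSup (ν i (e i))
    else 0

/-- Determinant of a square real matrix whose rows and columns are indexed by (possibly
different) finite linear orders of the same cardinality, the two index types being
identified with `Fin n` by the unique monotone bijections.  This realizes the determinant
of a submatrix obtained by deleting rows and columns (the determinant of the `0 × 0`
matrix being `1`). -/
noncomputable def gdet {I J : Type*} [Fintype I] [Fintype J] [LinearOrder I] [LinearOrder J]
    (A : Matrix I J ℝ) : ℝ :=
  ∑ e : I ≃ J,
    ((Equiv.Perm.sign ((monoEquivOfFin I rfl).toEquiv.trans
      (e.trans (monoEquivOfFin J (Fintype.card_congr e.symm)).toEquiv.symm)) : ℤ) : ℝ) *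
    ∏ i, A i (e i)

/-- The matrix `B` with row `r t` replaced by the standard basis vector at `c t`. -/
noncomputable def unitRows {s n : ℕ} (B : Matrix (Fin n) (Fin n) ℝ) (r c : Fin s → Fin n) :
    Matrix (Fin n) (Fin n) ℝ :=
  Matrix.of (Function.extend r (fun t => Pi.single (c t) 1) B)

theorem unitRows_apply {s n : ℕ} (B : Matrix (Fin n) (Fin n) ℝ) {r : Fin s → Fin n}
    (c : Fin s → Fin n) (hr : Function.Injective r) (t : Fin s) :
    unitRows B r c (r t) = Pi.single (c t) 1 :=
  hr.extend_apply (fun t => Pi.single (c t) 1) B t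

theorem unitRows_apply_of_forall_ne {s n : ℕ} (B : Matrix (Fin n) (Fin n) ℝ)
    {r : Fin s → Fin n} (c : Fin s → Fin n) {i : Fin n} (hi : ∀ t, r t ≠ i) :
    unitRows B r c i = B i :=
  Function.extend_apply' (fun t => Pi.single (c t) 1) B i fun ⟨t, ht⟩ => hi t ht

/-- The sum of the row (or column) numbers met when the lines `r 0, r 1, …` are deleted one
after the other. -/
noncomputable def laplaceExp {s n : ℕ} (r : Fin s → Fin n) : ℕ :=
  ∑ t : Fin s, ((r t : ℕ) - (Finset.univ.filter fun u => u < t ∧ r u < r t).card)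

theorem laplaceExp_succ {s n : ℕ} {r : Fin (s + 1) → Fin (n + 1)} {r' : Fin s → Fin n}
    (h : ∀ t, (r 0).succAbove (r' t) = r t.succ) :
    laplaceExp r = r 0 + laplaceExp r' := by
  unfold laplaceExp
  rw [Fin.sum_univ_succ]
  congr 1
  · simp
  · refine Finset.sum_congr rfl fun t _ => ?_
    rw [Fin.card_filter_univ_succ']
    have hcard : (Finset.univ.filter fun u : Fin s => u.succ < t.succ ∧ r u.succ < r t.succ).card
        = (Finset.univ.filter fun u => u < t ∧ r' u < r' t).card := by
      congr 1
      ext u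
      simp [← h]
    rw [hcard, ← h t]
    by_cases hlt : r 0 < (r 0).succAbove (r' t)
    · have hle := Fin.lt_succAbove_iff_le_castSucc _ _ |>.1 hlt
      rw [if_pos ⟨Fin.succ_pos t, hlt⟩, Fin.succAbove_of_le_castSucc _ _ hle, Fin.val_succ]
      omega
    · rw [if_neg fun h => hlt h.2]
      have hle := (Fin.lt_succAbove_iff_le_castSucc _ _).not.1 hlt
      rw [Fin.succAbove_of_castSucc_lt _ _ (not_le.1 hle), Fin.val_castSucc]
      omega

theorem exists_succAbove_factor {α : Type*} {n : ℕ} {a : Fin (n + 1)} {f : α → Fin (n + 1)}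
    (hf : ∀ x, f x ≠ a) : ∃ f' : α → Fin n, ∀ x, a.succAbove (f' x) = f x := by
  choose f' hf' using fun x => Fin.exists_succAbove_eq (hf x)
  exact ⟨f', hf'⟩

theorem compl_range_succAbove_factor {s k n : ℕ} {r : Fin (s + 1) → Fin (n + 1)}
    {r' : Fin s → Fin n} {f : Fin k → Fin (n + 1)} {f' : Fin k → Fin n}
    (hr' : ∀ t, (r 0).succAbove (r' t) = r t.succ)
    (hf' : ∀ x, (r 0).succAbove (f' x) = f x)
    (hfr : ∀ i, (∃ x, f x = i) ↔ ∀ t, r t ≠ i) :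
    ∀ i, (∃ x, f' x = i) ↔ ∀ t, r' t ≠ i := by
  intro i
  have := hfr ((r 0).succAbove i)
  simpa [Fin.forall_fin_succ, ← hr', ← hf', (Fin.succAbove_ne _ _).symm] using this

theorem det_unitRows {s n k : ℕ} (B : Matrix (Fin n) (Fin n) ℝ) {r c : Fin s → Fin n}
    (hr : Function.Injective r) (hc : Function.Injective c) {f g : Fin k → Fin n}
    (hf : StrictMono f) (hg : StrictMono g) (hfr : ∀ i, (∃ x, f x = i) ↔ ∀ t, r t ≠ i)
    (hgc : ∀ i, (∃ x, g x = i) ↔ ∀ t, c t ≠ i) :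
    (unitRows B r c).det = (-1) ^ (laplaceExp r + laplaceExp c) * (B.submatrix f g).det := by
  induction s generalizing n with
  | zero =>
    have hfs : Function.Surjective f := fun i => (hfr i).2 fun t => t.elim0
    have hgs : Function.Surjective g := fun i => (hgc i).2 fun t => t.elim0
    obtain rfl : k = n := by
      simpa using Fintype.card_of_bijective ⟨hf.injective, hfs⟩
    have hid : ∀ {f : Fin k → Fin k}, StrictMono f → Function.Surjective f → f = id :=
      fun hf hfs => (StrictMono.range_inj hf strictMono_id).1 (by simp [hfs.range_eq])
    have hB : unitRows B r c = B := by
      ext i j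
      rw [unitRows_apply_of_forall_ne _ _ fun t => t.elim0]
    rw [hid hf hfs, hid hg hgs, hB]
    simp [laplaceExp]
  | succ s ih =>
    obtain _ | n := n
    · exact (r 0).elim0
    obtain ⟨r', hr'⟩ := exists_succAbove_factor (a := r 0) (f := fun t : Fin s => r t.succ)
      fun t h => Fin.succ_ne_zero t (hr h)
    obtain ⟨c', hc'⟩ := exists_succAbove_factor (a := c 0) (f := fun t : Fin s => c t.succ)
      fun t h => Fin.succ_ne_zero t (hc h)
    obtain ⟨f', hf'⟩ := exists_succAbove_factor (a := r 0) (f := f)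
      fun x h => (hfr (f x)).1 ⟨x, rfl⟩ 0 h.symm
    obtain ⟨g', hg'⟩ := exists_succAbove_factor (a := c 0) (f := g)
      fun x h => (hgc (g x)).1 ⟨x, rfl⟩ 0 h.symm
    have hinj : ∀ {r : Fin (s + 1) → Fin (n + 1)} {r' : Fin s → Fin n},
        Function.Injective r → (∀ t, (r 0).succAbove (r' t) = r t.succ) →
        Function.Injective r' := by
      intro r r' hr h a b hab
      exact Fin.succ_injective _ (hr (by rw [← h, ← h, hab]))
    have hmono : ∀ {a : Fin (n + 1)} {f : Fin k → Fin (n + 1)} {f' : Fin k → Fin n},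
        StrictMono f → (∀ x, a.succAbove (f' x) = f x) → StrictMono f' := by
      intro a f f' hf h x y hxy
      have := hf hxy
      rwa [← h, ← h, Fin.succAbove_lt_succAbove_iff] at this
    have key := ih (B.submatrix (r 0).succAbove (c 0).succAbove) (hinj hr hr') (hinj hc hc')
      (hmono hf hf') (hmono hg hg') (compl_range_succAbove_factor hr' hf' hfr)
      (compl_range_succAbove_factor hc' hg' hgc)
    have hsub : (unitRows B r c).submatrix (r 0).succAbove (c 0).succAbove =
        unitRows (B.submatrix (r 0).succAbove (c 0).succAbove) r' c' := by
      ext i j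
      rw [Matrix.submatrix_apply]
      by_cases hi : ∃ t, r' t = i
      · obtain ⟨t, rfl⟩ := hi
        rw [hr', unitRows_apply _ _ hr, unitRows_apply _ _ (hinj hr hr'), ← hc']
        simp [Pi.single_apply]
      · push Not at hi
        rw [unitRows_apply_of_forall_ne _ _ hi, unitRows_apply_of_forall_ne]
        · rfl
        · intro t
          refine Fin.cases ?_ (fun t => ?_) t
          · exact (Fin.succAbove_ne _ _).symm
          · rw [← hr']
            exact fun h => hi t (Fin.succAbove_right_injective h)
    have hsubm : (B.submatrix (r 0).succAbove (c 0).succAbove).submatrix f' g' =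
        B.submatrix f g := by
      ext i j
      simp [hf', hg']
    rw [Matrix.det_succ_row _ (r 0), Finset.sum_eq_single (c 0), unitRows_apply _ _ hr, hsub,
      key, hsubm, laplaceExp_succ hr', laplaceExp_succ hc']
    · simp only [Pi.single_eq_same]
      ring
    · intro j _ hj
      rw [unitRows_apply _ _ hr, Pi.single_eq_of_ne hj]
      simp
    · simp

theorem gdet_eq_det {I J : Type*} [Fintype I] [Fintype J] [LinearOrder I] [LinearOrder J]
    (A : Matrix I J ℝ) {k : ℕ} (hI : Fintype.card I = k) (hJ : Fintype.card J = k) :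
    gdet A = (A.submatrix (monoEquivOfFin I hI) (monoEquivOfFin J hJ)).det := by
  subst hI
  rw [gdet, ← Matrix.det_transpose, Matrix.det_apply']
  refine Fintype.sum_equiv (Equiv.equivCongr (monoEquivOfFin I rfl).toEquiv.symm
    (monoEquivOfFin J hJ).toEquiv.symm) _ _ fun e => ?_
  congr 1
  rw [← (monoEquivOfFin I rfl).toEquiv.prod_comp]
  exact Finset.prod_congr rfl fun i _ => by simp

theorem card_forall_ne {s n : ℕ} {r : Fin s → Fin n} (hr : Function.Injective r) :
    Fintype.card {a : Fin n // ∀ t, r t ≠ a} = n - s := by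
  have h : Fintype.card {a : Fin n // ∀ t, r t ≠ a} = (Finset.univ.image r)ᶜ.card := by
    rw [Fintype.card_subtype]
    congr 1
    ext
    simp
  rw [h, Finset.card_compl, Finset.card_image_of_injective _ hr]
  simp

theorem det_unitRows_eq_gdet {s n : ℕ} (B : Matrix (Fin n) (Fin n) ℝ) {r c : Fin s → Fin n}
    (hr : Function.Injective r) (hc : Function.Injective c) :
    (unitRows B r c).det = (-1) ^ (laplaceExp r + laplaceExp c) *
      gdet (Matrix.of fun (a : {a : Fin n // ∀ t, r t ≠ a}) (b : {b : Fin n // ∀ t, c t ≠ b}) =>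
        B a.1 b.1) := by
  rw [gdet_eq_det _ (card_forall_ne hr) (card_forall_ne hc)]
  refine det_unitRows B hr hc
    (f := fun x => (monoEquivOfFin {a : Fin n // ∀ t, r t ≠ a} (card_forall_ne hr) x).1)
    (g := fun x => (monoEquivOfFin {a : Fin n // ∀ t, c t ≠ a} (card_forall_ne hc) x).1)
    (fun x y h => (monoEquivOfFin _ (card_forall_ne hr)).strictMono h)
    (fun x y h => (monoEquivOfFin _ (card_forall_ne hc)).strictMono h) ?_ ?_
  · intro i
    constructor
    · rintro ⟨x, rfl⟩
      exact (monoEquivOfFin {a : Fin n // ∀ t, r t ≠ a} (card_forall_ne hr) x).2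
    · intro hi
      exact ⟨(monoEquivOfFin _ (card_forall_ne hr)).symm ⟨i, hi⟩, by simp⟩
  · intro i
    constructor
    · rintro ⟨x, rfl⟩
      exact (monoEquivOfFin {a : Fin n // ∀ t, c t ≠ a} (card_forall_ne hc) x).2
    · intro hi
      exact ⟨(monoEquivOfFin _ (card_forall_ne hc)).symm ⟨i, hi⟩, by simp⟩

theorem prod_extend_one {s n : ℕ} {r : Fin s → Fin n} (hr : Function.Injective r)
    (v : Fin s → ℝ) : ∏ i, Function.extend r v 1 i = ∏ t, v t := by
  calc ∏ i, Function.extend r v 1 i = ∏ i ∈ Finset.univ.image r, Function.extend r v 1 i := by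
        refine (Finset.prod_subset (Finset.subset_univ _) fun i _ hi => ?_).symm
        rw [Function.extend_apply' _ _ _ fun h => hi (by simpa using h), Pi.one_apply]
    _ = ∏ t, v t := by
        rw [Finset.prod_image fun a _ b _ h => hr h]
        exact Finset.prod_congr rfl fun t _ => hr.extend_apply _ _ t

/-- The matrix with the entries `v t` at the positions `(r t, c t)` and `0` elsewhere. -/
noncomputable def positionMatrix {s n : ℕ} (r c : Fin s → Fin n) (v : Fin s → ℝ) :
    Matrix (Fin n) (Fin n) ℝ :=
  Matrix.of (Function.extend r (fun t => Pi.single (c t) (v t)) (0 : Fin n → Fin n → ℝ))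

theorem positionMatrix_apply {s n : ℕ} {r : Fin s → Fin n} (c : Fin s → Fin n) (v : Fin s → ℝ)
    (hr : Function.Injective r) (t : Fin s) :
    positionMatrix r c v (r t) = Pi.single (c t) (v t) :=
  hr.extend_apply (fun t => (Pi.single (c t) (v t) : Fin n → ℝ)) (0 : Fin n → Fin n → ℝ) t

theorem positionMatrix_apply_of_not_exists {s n : ℕ} {r : Fin s → Fin n} (c : Fin s → Fin n)
    (v : Fin s → ℝ) {i : Fin n} (hi : ¬ ∃ t, r t = i) : positionMatrix r c v i = 0 :=
  Function.extend_apply' (fun t => (Pi.single (c t) (v t) : Fin n → ℝ))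
    (0 : Fin n → Fin n → ℝ) i hi

/-- The leading coefficient of `T ↦ det (B + T • E)`, where `E` is `positionMatrix r c v`,
inherits the sign of this polynomial. -/
theorem nonneg_det_unitRows {s n : ℕ} (B : Matrix (Fin n) (Fin n) ℝ) {r : Fin s → Fin n}
    (c : Fin s → Fin n) (hr : Function.Injective r) (v : Fin s → ℝ) (d : ℝ)
    (h : ∀ T : ℝ, 0 < T → 0 ≤ d * (B + T • positionMatrix r c v).det) :
    0 ≤ d * ((∏ t, v t) * (unitRows B r c).det) := by
  have hEr := positionMatrix_apply c v hr
  have hE0 := fun i hi => positionMatrix_apply_of_not_exists (r := r) (i := i) c v hi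
  set E := positionMatrix r c v
  let M : ℝ → Matrix (Fin n) (Fin n) ℝ := fun ε =>
    Matrix.of fun i j => if ∃ t, r t = i then ε * B i j + E i j else B i j
  have hM : Continuous fun ε => d * (M ε).det := by
    refine continuous_const.mul (Continuous.matrix_det ?_)
    refine continuous_matrix fun i j => ?_
    by_cases hi : ∃ t, r t = i
    · simp only [M, Matrix.of_apply, if_pos hi]
      fun_prop
    · simp only [M, Matrix.of_apply, if_neg hi]
      fun_prop
  have hpos : ∀ ε : ℝ, 0 < ε → 0 ≤ d * (M ε).det := by
    intro ε hε
    have hMε : M ε = Matrix.of fun i j =>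
        (if ∃ t, r t = i then ε else 1) * (B + ε⁻¹ • E) i j := by
      ext i j
      by_cases hi : ∃ t, r t = i
      · simp only [M, Matrix.of_apply, if_pos hi, Matrix.add_apply, Matrix.smul_apply,
          smul_eq_mul]
        field_simp
      · simp [M, hi, hE0 i hi]
    rw [hMε, Matrix.det_mul_column, mul_left_comm]
    refine mul_nonneg (Finset.prod_nonneg fun i _ => ?_) (h _ (inv_pos.2 hε))
    split_ifs
    exacts [hε.le, zero_le_one]
  have hM0 : M 0 = Matrix.of fun i j => Function.extend r v 1 i * unitRows B r c i j := by
    ext i j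
    by_cases hi : ∃ t, r t = i
    · simp only [M, Matrix.of_apply, if_pos hi]
      obtain ⟨t, rfl⟩ := hi
      rw [hr.extend_apply, unitRows_apply _ _ hr, hEr]
      simp [Pi.single_apply]
    · simp only [M, Matrix.of_apply, if_neg hi]
      rw [Function.extend_apply' _ _ _ hi, unitRows_apply_of_forall_ne _ _ (by simpa using hi)]
      simp
  have hlim : 0 ≤ d * (M 0).det :=
    ge_of_tendsto ((hM.tendsto 0).mono_left nhdsWithin_le_nhds)
      (Filter.eventually_of_mem self_mem_nhdsWithin fun ε hε => hpos ε hε :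
        ∀ᶠ ε in nhdsWithin (0 : ℝ) (Set.Ioi 0), 0 ≤ d * (M ε).det)
  rwa [hM0, Matrix.det_mul_column, prod_extend_one hr] at hlim

theorem det_sum_smul {n : ℕ} {α : Type*} [Fintype α] (w : Fin n → α → ℝ)
    (x : Fin n → α → Fin n → ℝ) :
    (Matrix.of fun i => ∑ a, w i a • x i a).det =
      ∑ φ : Fin n → α, (∏ i, w i (φ i)) * (Matrix.of fun i => x i (φ i)).det := by
  have h1 := (Matrix.detRowAlternating (n := Fin n) (R := ℝ)).toMultilinearMap.map_sum
    fun i a => w i a • x i a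
  refine h1.trans (Finset.sum_congr rfl fun φ _ => ?_)
  exact (Matrix.detRowAlternating (n := Fin n) (R := ℝ)).toMultilinearMap.map_smul_univ
    (fun i => w i (φ i)) fun i => x i (φ i)

theorem exists_unitRows {n : ℕ} (B X : Matrix (Fin n) (Fin n) ℝ) (φ : Fin n → Option (Fin n)) :
    ∃ (s : ℕ) (r c : Fin s → Fin n), Function.Injective r ∧ (∀ t, φ (r t) = some (c t)) ∧
      (∀ i, (¬ ∃ t, r t = i) → φ i = none) ∧
      (Matrix.of fun i => (φ i).elim (B i) fun j => Pi.single j 1) = unitRows B r c ∧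
      ∏ i, (φ i).elim 1 (X i) = ∏ t, X (r t) (c t) := by
  let U : Finset (Fin n) := Finset.univ.filter fun i => φ i ≠ none
  let r : Fin U.card → Fin n := fun t => (U.equivFin.symm t).1
  have hrU : ∀ t, φ (r t) ≠ none := fun t => by
    have := (U.equivFin.symm t).2
    simpa only [U, Finset.mem_filter, Finset.mem_univ, true_and] using this
  choose c hc using fun t => Option.ne_none_iff_exists'.1 (hrU t)
  have hr : Function.Injective r := fun a b hab => U.equivFin.symm.injective (Subtype.ext hab)
  have hnone : ∀ i, (¬ ∃ t, r t = i) → φ i = none := by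
    intro i hi
    by_contra hne
    exact hi ⟨U.equivFin ⟨i, by simp [U, hne]⟩, by simp [r]⟩
  refine ⟨U.card, r, c, hr, hc, hnone, ?_, ?_⟩
  · ext1 i
    by_cases hi : ∃ t, r t = i
    · obtain ⟨t, rfl⟩ := hi
      rw [unitRows_apply _ _ hr]
      simp [hc]
    · rw [unitRows_apply_of_forall_ne _ _ (by simpa using hi)]
      simp [hnone i hi]
  · rw [← prod_extend_one hr]
    refine Finset.prod_congr rfl fun i _ => ?_
    by_cases hi : ∃ t, r t = i
    · obtain ⟨t, rfl⟩ := hi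
      rw [hr.extend_apply, hc]
      rfl
    · rw [Function.extend_apply' _ _ _ hi, hnone i hi]
      rfl

theorem mul_det_le_mul_det_add {n : ℕ} (B X : Matrix (Fin n) (Fin n) ℝ) (d : ℝ)
    (h : ∀ s : ℕ, 1 ≤ s → ∀ r c : Fin s → Fin n, Function.Injective r → Function.Injective c →
      (∀ t, X (r t) (c t) ≠ 0) → 0 ≤ d * ((∏ t, X (r t) (c t)) * (unitRows B r c).det)) :
    d * B.det ≤ d * (B + X).det := by
  have hBX : B + X = Matrix.of fun i => ∑ o : Option (Fin n),
      o.elim 1 (X i) • o.elim (B i) fun j => Pi.single j 1 := by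
    ext i j
    simp [Fintype.sum_option, Pi.single_apply]
  rw [hBX, det_sum_smul, ← Finset.add_sum_erase _ _ (Finset.mem_univ fun _ => none), mul_add]
  refine le_add_of_le_of_nonneg (le_of_eq ?_) ?_
  · simp only [Option.elim_none, Finset.prod_const_one, one_mul]
    rfl
  rw [Finset.mul_sum]
  refine Finset.sum_nonneg fun φ hφ => ?_
  obtain ⟨s, r, c, hr, hc, hnone, hmat, hprod⟩ := exists_unitRows B X φ
  rw [hmat, hprod]
  by_cases hX : ∀ t, X (r t) (c t) ≠ 0
  swap
  · push Not at hX
    obtain ⟨t, ht⟩ := hX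
    rw [Finset.prod_eq_zero (Finset.mem_univ t) ht]
    simp
  by_cases hci : Function.Injective c
  swap
  · simp only [Function.Injective, not_forall] at hci
    obtain ⟨a, b, hab, hne⟩ := hci
    rw [Matrix.det_zero_of_row_eq (hr.ne hne)
      (by rw [unitRows_apply _ _ hr, unitRows_apply _ _ hr, hab])]
    simp
  refine h s ?_ r c hr hci hX
  by_contra hs
  obtain rfl : s = 0 := by omega
  exact Finset.ne_of_mem_erase hφ (funext fun i => hnone i fun ⟨t, _⟩ => t.elim0)

theorem det_convex_rows_pos {n : ℕ} (d : ℝ) (P Q : Matrix (Fin n) (Fin n) ℝ) (l : Fin n → ℝ)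
    (hl0 : ∀ i, 0 ≤ l i) (hl1 : ∀ i, l i ≤ 1)
    (h : ∀ y : Fin n → Bool, 0 < d * (Matrix.of fun i => if y i then P i else Q i).det) :
    0 < d * (Matrix.of fun i => (1 - l i) • P i + l i • Q i).det := by
  have hrow : (Matrix.of fun i => (1 - l i) • P i + l i • Q i) =
      Matrix.of fun i => ∑ b : Bool, (if b then 1 - l i else l i) • if b then P i else Q i := by
    simp
  rw [hrow, det_sum_smul, Finset.mul_sum]
  have hw : ∀ i (b : Bool), 0 ≤ if b then 1 - l i else l i := by
    intro i b
    split_ifs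
    exacts [sub_nonneg.2 (hl1 i), hl0 i]
  refine Finset.sum_pos' (fun y _ => ?_) ⟨fun i => decide (l i < 1), Finset.mem_univ _, ?_⟩
  · rw [mul_left_comm]
    exact mul_nonneg (Finset.prod_nonneg fun i _ => hw i _) (h y).le
  · rw [mul_left_comm]
    refine mul_pos (Finset.prod_pos fun i _ => ?_) (h _)
    by_cases hi : l i < 1
    · simp [hi]
    · simp only [hi, decide_false, Bool.false_eq_true, if_false]
      linarith

/-- Rohn's criterion for the regularity of an interval matrix. -/
theorem det_ne_zero_of_corners {n : ℕ} (d : ℝ) {lo hi A : Matrix (Fin n) (Fin n) ℝ}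
    (hlo : ∀ i j, lo i j ≤ A i j) (hhi : ∀ i j, A i j ≤ hi i j)
    (h : ∀ y z : Fin n → Bool,
      0 < d * (Matrix.of fun i j => if y i = z j then lo i j else hi i j).det) :
    A.det ≠ 0 := by
  intro hA
  obtain ⟨v, hv, hAv⟩ := Matrix.exists_mulVec_eq_zero_iff.2 hA
  let z : Fin n → Bool := fun j => decide (0 ≤ v j)
  let P : Matrix (Fin n) (Fin n) ℝ := Matrix.of fun i j => if true = z j then lo i j else hi i j
  let Q : Matrix (Fin n) (Fin n) ℝ := Matrix.of fun i j => if false = z j then lo i j else hi i j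
  have hP : ∀ i, P.mulVec v i ≤ 0 := by
    intro i
    rw [← show A.mulVec v i = 0 from congrFun hAv i]
    change ∑ j, P i j * v j ≤ ∑ j, A i j * v j
    refine Finset.sum_le_sum fun j _ => ?_
    by_cases hj : 0 ≤ v j
    · simpa [P, z, hj] using mul_le_mul_of_nonneg_right (hlo i j) hj
    · simpa [P, z, hj] using mul_le_mul_of_nonpos_right (hhi i j) (not_le.1 hj).le
  have hQ : ∀ i, 0 ≤ Q.mulVec v i := by
    intro i
    rw [← show A.mulVec v i = 0 from congrFun hAv i]
    change ∑ j, A i j * v j ≤ ∑ j, Q i j * v j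
    refine Finset.sum_le_sum fun j _ => ?_
    by_cases hj : 0 ≤ v j
    · simpa [Q, z, hj, hj.not_gt] using mul_le_mul_of_nonneg_right (hhi i j) hj
    · simpa [Q, z, hj, not_le.1 hj] using mul_le_mul_of_nonpos_right (hlo i j) (not_le.1 hj).le
  have hl : ∀ i, ∃ l : ℝ, 0 ≤ l ∧ l ≤ 1 ∧
      (1 - l) * P.mulVec v i + l * Q.mulVec v i = 0 := by
    intro i
    obtain heq | hlt := ((hP i).trans (hQ i)).eq_or_lt
    · exact ⟨0, le_rfl, zero_le_one, by linarith [hP i, hQ i]⟩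
    · have hsub := sub_pos.2 hlt
      refine ⟨-P.mulVec v i / (Q.mulVec v i - P.mulVec v i),
        div_nonneg (neg_nonneg.2 (hP i)) hsub.le, ?_, ?_⟩
      · rw [div_le_one hsub]
        linarith [hQ i]
      · field_simp
        ring
  choose l hl0 hl1 hl using hl
  have hpos := det_convex_rows_pos d P Q l hl0 hl1 fun y => by
    convert h y z using 4 with i j
    ext i j
    cases hy : y i <;> simp [P, Q]
  refine hpos.ne' ?_
  rw [Matrix.exists_mulVec_eq_zero_iff.1 ⟨v, hv, ?_⟩, mul_zero]
  ext i
  rw [Pi.zero_apply, ← hl i]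
  simp only [Matrix.mulVec, dotProduct, Matrix.of_apply, Pi.add_apply, Pi.smul_apply, smul_eq_mul,
    add_mul, Finset.sum_add_distrib, Finset.mul_sum, mul_assoc]

theorem entry_cases {S : Set ℝ} (hS : IsClosed S ∧ S.Nonempty ∧ IsPreconnected S) :
    IsBddEntry S ∨ IsLeftB S ∨ IsRightB S ∨ S = Set.univ := by
  obtain ⟨hc, hn, hp⟩ := hS
  have hord := hp.ordConnected
  by_cases hb : BddBelow S <;> by_cases ha : BddAbove S
  · refine Or.inl ⟨sInf S, sSup S, csInf_le_csSup hn hb ha, subset_antisymm ?_ ?_⟩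
    · exact fun x hx => ⟨csInf_le hb hx, le_csSup ha hx⟩
    · exact hord.out (hc.csInf_mem hn hb) (hc.csSup_mem hn ha)
  · refine Or.inr (Or.inl ⟨sInf S, subset_antisymm (fun x hx => csInf_le hb hx) fun x hx => ?_⟩)
    obtain ⟨y, hy, hxy⟩ := not_bddAbove_iff.1 ha x
    exact hord.out (hc.csInf_mem hn hb) hy ⟨hx, hxy.le⟩
  · refine Or.inr (Or.inr (Or.inl
      ⟨sSup S, subset_antisymm (fun x hx => le_csSup ha hx) fun x hx => ?_⟩))
    obtain ⟨y, hy, hxy⟩ := not_bddBelow_iff.1 hb x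
    exact hord.out hy (hc.csSup_mem hn ha) ⟨hxy.le, hx⟩
  · refine Or.inr (Or.inr (Or.inr (Set.eq_univ_of_forall fun x => ?_)))
    obtain ⟨y, hy, hxy⟩ := not_bddBelow_iff.1 hb x
    obtain ⟨w, hw, hxw⟩ := not_bddAbove_iff.1 ha x
    exact hord.out hy hw ⟨hxy.le, hxw.le⟩

theorem isBddEntry_Icc {a b : ℝ} (h : a ≤ b) : IsBddEntry (Set.Icc a b) := ⟨a, b, h, rfl⟩

theorem not_isBddEntry_Ici (a : ℝ) : ¬ IsBddEntry (Set.Ici a) := by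
  rintro ⟨b, c, -, h⟩
  exact not_bddAbove_Ici a (h ▸ bddAbove_Icc)

theorem not_isBddEntry_Iic (a : ℝ) : ¬ IsBddEntry (Set.Iic a) := by
  rintro ⟨b, c, -, h⟩
  exact not_bddBelow_Iic a (h ▸ bddBelow_Icc)

theorem not_isLeftB_Icc (a b : ℝ) : ¬ IsLeftB (Set.Icc a b) := by
  rintro ⟨c, h⟩
  exact not_bddAbove_Ici c (h ▸ bddAbove_Icc)

theorem not_isRightB_Icc (a b : ℝ) : ¬ IsRightB (Set.Icc a b) := by
  rintro ⟨c, h⟩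
  exact not_bddBelow_Iic c (h ▸ bddBelow_Icc)

theorem not_isLeftB_Iic (a : ℝ) : ¬ IsLeftB (Set.Iic a) := by
  rintro ⟨c, h⟩
  exact not_bddAbove_Ici c (h ▸ bddAbove_Iic)

theorem not_isRightB_Ici (a : ℝ) : ¬ IsRightB (Set.Ici a) := by
  rintro ⟨c, h⟩
  exact not_bddBelow_Iic c (h ▸ bddBelow_Ici)

theorem Icc_ne_univ_real (a b : ℝ) : Set.Icc a b ≠ Set.univ :=
  fun h => not_bddAbove_univ (h ▸ bddAbove_Icc)

theorem Ici_ne_univ_real (a : ℝ) : Set.Ici a ≠ Set.univ :=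
  fun h => not_bddBelow_univ (h ▸ bddBelow_Ici)

theorem Iic_ne_univ_real (a : ℝ) : Set.Iic a ≠ Set.univ :=
  fun h => not_bddAbove_univ (h ▸ bddAbove_Iic)

theorem pick_Icc {a b : ℝ} (h : a ≤ b) : pick (Set.Icc a b) = a := by
  rw [pick, if_pos bddBelow_Icc, csInf_Icc h]

theorem pick_Ici (a : ℝ) : pick (Set.Ici a) = a := by
  rw [pick, if_pos bddBelow_Ici, csInf_Ici]

theorem pick_Iic (a : ℝ) : pick (Set.Iic a) = a := by
  rw [pick, if_neg (not_bddBelow_Iic a), csSup_Iic]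

theorem pick_singleton (a : ℝ) : pick {a} = a := by
  rw [pick, if_pos bddBelow_singleton, csInf_singleton]

section entries

variable {I J : Type*} {μ : Matrix I J (Set ℝ)} {i : I} {j : J}

theorem tildeM_of_eq_univ (h : μ i j = Set.univ) : tildeM μ i j = Set.Icc 0 0 := by
  simp [tildeM, h]

theorem tildeM_of_ne_univ (h : μ i j ≠ Set.univ) : tildeM μ i j = μ i j := by
  simp [tildeM, h]

theorem barM_of_Icc {a b : ℝ} (h : μ i j = Set.Icc a b) : barM μ i j = Set.Icc a b := by
  simp [barM, h, not_isLeftB_Icc, not_isRightB_Icc]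

theorem barM_of_Ici {a : ℝ} (h : μ i j = Set.Ici a) : barM μ i j = Set.Icc a a := by
  have h1 : IsLeftB (Set.Ici a) := ⟨a, rfl⟩
  simp [barM, h, h1]

theorem barM_of_Iic {a : ℝ} (h : μ i j = Set.Iic a) : barM μ i j = Set.Icc a a := by
  have h1 : IsRightB (Set.Iic a) := ⟨a, rfl⟩
  simp [barM, h, h1, not_isLeftB_Iic]

theorem tildeM_cases (hμ : GCIM μ) (i : I) (j : J) :
    (∃ a b, a ≤ b ∧ tildeM μ i j = Set.Icc a b ∧ Set.Icc a b ⊆ μ i j ∧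
      ¬ IsLeftB (μ i j) ∧ ¬ IsRightB (μ i j)) ∨
    (∃ a, tildeM μ i j = Set.Ici a ∧ μ i j = Set.Ici a) ∨
    (∃ a, tildeM μ i j = Set.Iic a ∧ μ i j = Set.Iic a) := by
  obtain ⟨a, b, hab, h⟩ | ⟨a, h⟩ | ⟨a, h⟩ | h := entry_cases (hμ i j)
  · refine Or.inl ⟨a, b, hab, ?_, h.ge, h ▸ not_isLeftB_Icc a b, h ▸ not_isRightB_Icc a b⟩
    rw [tildeM_of_ne_univ (h ▸ Icc_ne_univ_real a b), h]
  · refine Or.inr (Or.inl ⟨a, ?_, h⟩)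
    rw [tildeM_of_ne_univ (h ▸ Ici_ne_univ_real a), h]
  · refine Or.inr (Or.inr ⟨a, ?_, h⟩)
    rw [tildeM_of_ne_univ (h ▸ Iic_ne_univ_real a), h]
  · refine Or.inl ⟨0, 0, le_rfl, tildeM_of_eq_univ h, h ▸ Set.subset_univ _, ?_, ?_⟩
    · rintro ⟨a, ha⟩
      exact Ici_ne_univ_real a (ha.symm.trans h)
    · rintro ⟨a, ha⟩
      exact Iic_ne_univ_real a (ha.symm.trans h)

theorem IsVertex.eq_of_Icc {ν γ : Matrix I J (Set ℝ)} (h : IsVertex ν γ) {a b : ℝ} (hab : a ≤ b)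
    (hν : ν i j = Set.Icc a b) : γ i j = {a} ∨ γ i j = {b} := by
  have := (h i j).1 (hν ▸ isBddEntry_Icc hab)
  rwa [hν, csInf_Icc hab, csSup_Icc hab] at this

theorem contains_pick_tildeM (hμ : GCIM μ) :
    Contains μ (Matrix.of fun i j => pick (tildeM μ i j)) := by
  intro i j
  rw [Matrix.of_apply]
  obtain ⟨a, b, hab, h, hsub, -⟩ | ⟨a, h, h'⟩ | ⟨a, h, h'⟩ := tildeM_cases hμ i j
  · rw [h, pick_Icc hab]
    exact hsub ⟨le_rfl, hab⟩
  · rw [h, h', pick_Ici]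
    exact Set.self_mem_Ici
  · rw [h, h', pick_Iic]
    exact Set.self_mem_Iic

theorem contains_pick_of_isVertex_barM (hμ : GCIM μ) {γ : Matrix I J (Set ℝ)}
    (hγ : IsVertex (barM (tildeM μ)) γ) : Contains μ (Matrix.of fun i j => pick (γ i j)) := by
  intro i j
  rw [Matrix.of_apply]
  obtain ⟨a, b, hab, h, hsub, -⟩ | ⟨a, h, h'⟩ | ⟨a, h, h'⟩ := tildeM_cases hμ i j
  · obtain h1 | h1 := hγ.eq_of_Icc hab (barM_of_Icc h)
    · rw [h1, pick_singleton]
      exact hsub ⟨le_rfl, hab⟩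
    · rw [h1, pick_singleton]
      exact hsub ⟨hab, le_rfl⟩
  · have h1 := hγ.eq_of_Icc le_rfl (barM_of_Ici h)
    rw [or_self_iff] at h1
    rw [h1, h', pick_singleton]
    exact Set.self_mem_Ici
  · have h1 := hγ.eq_of_Icc le_rfl (barM_of_Iic h)
    rw [or_self_iff] at h1
    rw [h1, h', pick_singleton]
    exact Set.self_mem_Iic

theorem contains_pick_of_isVertex (hμ : GCIM μ) {γ : Matrix I J (Set ℝ)}
    (hγ : IsVertex (tildeM μ) γ) : Contains μ (Matrix.of fun i j => pick (γ i j)) := by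
  intro i j
  rw [Matrix.of_apply]
  obtain ⟨a, b, hab, h, hsub, -⟩ | ⟨a, h, h'⟩ | ⟨a, h, h'⟩ := tildeM_cases hμ i j
  · obtain h1 | h1 := hγ.eq_of_Icc hab h
    · rw [h1, pick_singleton]
      exact hsub ⟨le_rfl, hab⟩
    · rw [h1, pick_singleton]
      exact hsub ⟨hab, le_rfl⟩
  · rw [(hγ i j).2 (h ▸ not_isBddEntry_Ici a), h, h', pick_Ici]
    exact Set.self_mem_Ici
  · rw [(hγ i j).2 (h ▸ not_isBddEntry_Iic a), h, h', pick_Iic]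
    exact Set.self_mem_Iic

/-- The vertex matrix of `ν` with the left endpoint at the bounded entries `(i, j)` such that
`y i = z j`, and the right endpoint at the other bounded entries. -/
noncomputable def cornerM (ν : Matrix I J (Set ℝ)) (y : I → Bool) (z : J → Bool) :
    Matrix I J (Set ℝ) :=
  Matrix.of fun i j =>
    if IsBddEntry (ν i j) then {if y i = z j then sInf (ν i j) else sSup (ν i j)} else ν i j

theorem isVertex_cornerM (ν : Matrix I J (Set ℝ)) (y : I → Bool) (z : J → Bool) :
    IsVertex ν (cornerM ν y z) := by
  intro i j
  refine ⟨fun h => ?_, fun h => by simp [cornerM, h]⟩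
  by_cases hyz : y i = z j <;> simp [cornerM, h, hyz]

theorem cornerM_of_Icc {ν : Matrix I J (Set ℝ)} (y : I → Bool) (z : J → Bool) {a b : ℝ}
    (hab : a ≤ b) (h : ν i j = Set.Icc a b) :
    cornerM ν y z i j = {if y i = z j then a else b} := by
  simp [cornerM, h, isBddEntry_Icc hab, csInf_Icc hab, csSup_Icc hab]

theorem cornerM_eq_sInf_iff {ν : Matrix I J (Set ℝ)} (y : I → Bool) (z : J → Bool)
    (hb : IsBddEntry (ν i j)) (hc : ¬ IsConst (ν i j)) :
    cornerM ν y z i j = {sInf (ν i j)} ↔ y i = z j := by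
  obtain ⟨a, b, hab, h⟩ := hb
  have hne : b ≠ a := by
    rintro rfl
    exact hc ⟨b, by simp [h]⟩
  rw [cornerM_of_Icc y z hab h, h, csInf_Icc hab, Set.singleton_eq_singleton_iff]
  split_ifs with hyz <;> simp [hyz, hne]

theorem evenTypeG_cornerM (ν : Matrix I J (Set ℝ)) (y : I → Bool) (z : J → Bool) :
    EvenTypeG ν (cornerM ν y z) := by
  rintro i1 i2 j1 j2 - - ⟨h11, h12, h21, h22⟩
  by_contra! h
  obtain ⟨⟨c11, c12, c21, c22⟩, hodd⟩ := h
  simp only [cornerM_eq_sInf_iff y z h11 c11, cornerM_eq_sInf_iff y z h12 c12,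
    cornerM_eq_sInf_iff y z h21 c21, cornerM_eq_sInf_iff y z h22 c22] at hodd
  revert hodd
  generalize y i1 = a, y i2 = b, z j1 = c, z j2 = d
  revert a b c d
  decide

theorem pick_cornerM_barM (hμ : GCIM μ) (y : I → Bool) (z : J → Bool) :
    pick (cornerM (barM (tildeM μ)) y z i j) = pick (cornerM (tildeM μ) y z i j) := by
  obtain ⟨a, b, hab, h, -⟩ | ⟨a, h, -⟩ | ⟨a, h, -⟩ := tildeM_cases hμ i j
  · rw [cornerM_of_Icc y z hab h, cornerM_of_Icc y z hab (barM_of_Icc h)]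
  · rw [cornerM_of_Icc y z le_rfl (barM_of_Ici h), ite_self, pick_singleton,
      (isVertex_cornerM (tildeM μ) y z i j).2 (h ▸ not_isBddEntry_Ici a), h, pick_Ici]
  · rw [cornerM_of_Icc y z le_rfl (barM_of_Iic h), ite_self, pick_singleton,
      (isVertex_cornerM (tildeM μ) y z i j).2 (h ▸ not_isBddEntry_Iic a), h, pick_Iic]

end entries

theorem det_add_smul_single {n : ℕ} (A : Matrix (Fin n) (Fin n) ℝ) (i j : Fin n) (x : ℝ) :
    (A + x • Matrix.single i j 1).det = A.det + x * A.adjugate j i := by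
  have h : A + x • Matrix.single i j 1 = A.updateRow i (A i + x • Pi.single j 1) := by
    ext a b
    by_cases ha : a = i
    · subst ha
      simp [Matrix.single_apply, Pi.single_apply, eq_comm]
    · simp [ha, Ne.symm ha]
  rw [h, Matrix.det_updateRow_add, Matrix.det_updateRow_smul, Matrix.updateRow_eq_self,
    Matrix.adjugate_apply]

theorem add_smul_single_apply_of_ne {n : ℕ} (A : Matrix (Fin n) (Fin n) ℝ) {i j a b : Fin n}
    (x : ℝ) (h : ¬ (a = i ∧ b = j)) : (A + x • Matrix.single i j (1 : ℝ)) a b = A a b := by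
  have h' : ¬ (i = a ∧ j = b) := fun h' => h ⟨h'.1.symm, h'.2.symm⟩
  simp [h']

theorem add_smul_single_apply_same {n : ℕ} (A : Matrix (Fin n) (Fin n) ℝ) (i j : Fin n)
    (x : ℝ) : (A + x • Matrix.single i j (1 : ℝ)) i j = A i j + x := by
  simp

/-- The real matrix with the constant entries of `M`, and `0` at the nonconstant entries. -/
noncomputable def constPart {I J : Type*} (M : Matrix I J (Set ℝ)) : Matrix I J ℝ :=
  Matrix.of fun a b => if IsConst (M a b) then sSup (M a b) else 0

theorem constPart_mem {I J : Type*} {M : Matrix I J (Set ℝ)} {a : I} {b : J}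
    (h : IsConst (M a b)) : constPart M a b ∈ M a b := by
  obtain ⟨x, hx⟩ := h
  have h' : IsConst {x} := ⟨x, rfl⟩
  simp [constPart, hx, h']

theorem detc_eq_gdet {I J : Type*} [Fintype I] [Fintype J] [LinearOrder I] [LinearOrder J]
    (M : Matrix I J (Set ℝ)) : detc M = gdet (constPart M) := by
  refine Finset.sum_congr rfl fun e _ => ?_
  split_ifs with h
  · congr 1
    exact Finset.prod_congr rfl fun i _ => by simp [constPart, h i]
  · push Not at h
    obtain ⟨i, hi⟩ := h
    rw [Finset.prod_eq_zero (Finset.mem_univ i) (by simp [constPart, hi]), mul_zero]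

theorem detc_conditions_iff {p : ℕ} (M : Matrix (Fin p) (Fin p) (Set ℝ)) :
    ((¬ ∃ r c : Fin p → Fin p, Function.Injective r ∧ Function.Injective c ∧
        ∀ t, ¬ IsConst (M (r t) (c t))) ∧
      (∀ k : ℕ, k < p → ∀ r c : Fin k → Fin p, Function.Injective r → Function.Injective c →
        (∀ t, ¬ IsConst (M (r t) (c t))) →
        detc (Matrix.of fun (a : {a : Fin p // ∀ t, r t ≠ a})
          (b : {b : Fin p // ∀ t, c t ≠ b}) => M a.1 b.1) = 0)) ↔
    ∀ (k : ℕ) (r c : Fin k → Fin p), Function.Injective r → Function.Injective c →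
      (∀ t, ¬ IsConst (M (r t) (c t))) → (unitRows (constPart M) r c).det = 0 := by
  have hdetc : ∀ (k : ℕ) (r c : Fin k → Fin p), Function.Injective r → Function.Injective c →
      ((unitRows (constPart M) r c).det = 0 ↔
        detc (Matrix.of fun (a : {a : Fin p // ∀ t, r t ≠ a})
          (b : {b : Fin p // ∀ t, c t ≠ b}) => M a.1 b.1) = 0) := by
    intro k r c hr hc
    rw [det_unitRows_eq_gdet _ hr hc, detc_eq_gdet, mul_eq_zero_iff_left (by simp)]
    rfl
  have hfull : ∀ r c : Fin p → Fin p, Function.Injective r → Function.Injective c →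
      (unitRows (constPart M) r c).det ≠ 0 := by
    intro r c hr hc
    have hsurj : ∀ {r : Fin p → Fin p}, Function.Injective r → ∀ i,
        (∃ x : Fin 0, (x.elim0 : Fin p) = i) ↔ ∀ t, r t ≠ i := by
      intro r hr i
      obtain ⟨t, ht⟩ := Finite.injective_iff_surjective.1 hr i
      exact ⟨fun ⟨x, _⟩ => x.elim0, fun h => absurd ht (h t)⟩
    rw [det_unitRows (constPart M) hr hc (f := fun x : Fin 0 => x.elim0)
      (g := fun x : Fin 0 => x.elim0) (fun x => x.elim0) (fun x => x.elim0) (hsurj hr) (hsurj hc)]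
    simp
  constructor
  · rintro ⟨h1, h2⟩ k r c hr hc hrc
    obtain hk | rfl | hk := lt_trichotomy k p
    · exact (hdetc k r c hr hc).2 (h2 k hk r c hr hc hrc)
    · exact absurd ⟨r, c, hr, hc, hrc⟩ h1
    · exact absurd (by simpa using Fintype.card_le_of_injective r hr) hk.not_ge
  · intro h
    exact ⟨fun ⟨r, c, hr, hc, hrc⟩ => hfull r c hr hc (h p r c hr hc hrc),
      fun k _ r c hr hc hrc => (hdetc k r c hr hc).1 (h k r c hr hc hrc)⟩

theorem det_eq_zero_of_unitRows {p : ℕ} {M : Matrix (Fin p) (Fin p) (Set ℝ)}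
    (h : ∀ (k : ℕ) (r c : Fin k → Fin p), Function.Injective r → Function.Injective c →
      (∀ t, ¬ IsConst (M (r t) (c t))) → (unitRows (constPart M) r c).det = 0)
    {Q : Matrix (Fin p) (Fin p) ℝ} (hQ : Contains M Q) : Q.det = 0 := by
  have h0 : (constPart M).det = 0 := by
    have := h 0 Fin.elim0 Fin.elim0 (fun x => x.elim0) (fun x => x.elim0) fun x => x.elim0
    rwa [show unitRows (constPart M) Fin.elim0 Fin.elim0 = constPart M from by
      ext i j
      rw [unitRows_apply_of_forall_ne _ _ fun t => t.elim0]] at this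
  have hX : ∀ a b, (Q - constPart M) a b ≠ 0 → ¬ IsConst (M a b) := by
    intro a b hab hc
    obtain ⟨x, hx⟩ := id hc
    have h1 := hQ a b
    have h2 := constPart_mem hc
    rw [hx, Set.mem_singleton_iff] at h1 h2
    exact hab (by rw [Matrix.sub_apply, h1, h2, sub_self])
  have hle : ∀ d : ℝ, 0 ≤ d * Q.det := by
    intro d
    have := mul_det_le_mul_det_add (constPart M) (Q - constPart M) d fun s _ r c hr hc hrc => by
      rw [h s r c hr hc fun t => hX _ _ (hrc t)]
      simp
    rwa [h0, mul_zero, add_sub_cancel] at this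
  linarith [hle 1, hle (-1)]

theorem det_eq_zero_of_const_mem {p : ℕ} {M : Matrix (Fin p) (Fin p) (Set ℝ)} (hM : GCIM M)
    (h : ∀ Q, Contains M Q → Q.det = 0) (Q : Matrix (Fin p) (Fin p) ℝ)
    (hQ : ∀ a b, IsConst (M a b) → Q a b ∈ M a b) : Q.det = 0 := by
  have key : ∀ (F : Finset (Fin p × Fin p)) (Q : Matrix (Fin p) (Fin p) ℝ),
      (∀ a b, IsConst (M a b) → Q a b ∈ M a b) → (∀ a b, (a, b) ∉ F → Q a b ∈ M a b) →
      Q.det = 0 := by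
    intro F
    induction F using Finset.induction_on with
    | empty => exact fun Q _ hF => h Q fun a b => hF a b (Finset.notMem_empty _)
    | insert e F _ ih =>
      obtain ⟨i, j⟩ := e
      intro Q hQ hF
      by_cases hc : IsConst (M i j)
      · refine ih Q hQ fun a b hab => ?_
        by_cases he : (a, b) = (i, j)
        · obtain ⟨rfl, rfl⟩ := Prod.mk.inj he
          exact hQ _ _ hc
        · exact hF a b (by simp [he, hab])
      obtain ⟨x, hx⟩ := (hM i j).2.1
      have hy : ∃ y ∈ M i j, y ≠ x := by
        by_contra! hy
        exact hc ⟨x, Set.eq_singleton_iff_unique_mem.2 ⟨hx, hy⟩⟩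
      obtain ⟨y, hy, hyx⟩ := hy
      have hz : ∀ z ∈ M i j, Q.det + (z - Q i j) * Q.adjugate j i = 0 := by
        intro z hz
        rw [← det_add_smul_single]
        have hmem : ∀ a b, ((a = i ∧ b = j) ∨ Q a b ∈ M a b) →
            (Q + (z - Q i j) • Matrix.single i j (1 : ℝ)) a b ∈ M a b := by
          intro a b hab
          by_cases he : a = i ∧ b = j
          · obtain ⟨rfl, rfl⟩ := he
            rwa [add_smul_single_apply_same, add_sub_cancel]
          · rw [add_smul_single_apply_of_ne _ _ he]
            exact hab.resolve_left he
        refine ih _ (fun a b hab => hmem a b (Or.inr (hQ a b hab))) fun a b hab => ?_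
        by_cases he : a = i ∧ b = j
        · exact hmem a b (Or.inl he)
        · exact hmem a b (Or.inr (hF a b (by simp [he, hab])))
      have hxy : (y - x) * Q.adjugate j i = 0 := by linear_combination hz y hy - hz x hx
      have hadj := (mul_eq_zero.1 hxy).resolve_left (sub_ne_zero.2 hyx)
      simpa [hadj] using hz x hx
  exact key Finset.univ Q hQ fun a b hab => absurd (Finset.mem_univ _) hab

theorem unitRows_det_eq_zero {p : ℕ} {M : Matrix (Fin p) (Fin p) (Set ℝ)} (hM : GCIM M)
    (h : ∀ Q, Contains M Q → Q.det = 0) {k : ℕ} {r c : Fin k → Fin p}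
    (hr : Function.Injective r) (hrc : ∀ t, ¬ IsConst (M (r t) (c t))) :
    (unitRows (constPart M) r c).det = 0 := by
  have hle : ∀ d : ℝ, 0 ≤ d * (unitRows (constPart M) r c).det := by
    intro d
    have := nonneg_det_unitRows (constPart M) c hr (fun _ => 1) d fun T _ => by
      rw [det_eq_zero_of_const_mem hM h, mul_zero]
      intro a b hab
      by_cases ha : ∃ t, r t = a
      · obtain ⟨t, rfl⟩ := ha
        have hb : b ≠ c t := fun hb => hrc t (hb ▸ hab)
        rw [Matrix.add_apply, Matrix.smul_apply, positionMatrix_apply _ _ hr,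
          Pi.single_eq_of_ne hb, smul_zero, add_zero]
        exact constPart_mem hab
      · rw [Matrix.add_apply, Matrix.smul_apply, positionMatrix_apply_of_not_exists _ _ ha,
          Pi.zero_apply, smul_zero, add_zero]
        exact constPart_mem hab
    simpa using this
  linarith [hle 1, hle (-1)]

theorem det_submatrix_eq_zero {p : ℕ} {μ : Matrix (Fin (p + 1)) (Fin (p + 1)) (Set ℝ)}
    (hμ : GCIM μ) (h : ∀ A, Contains μ A → A.det ≠ 0) {i j : Fin (p + 1)}
    (hij : μ i j = Set.univ) {Q : Matrix (Fin p) (Fin p) ℝ}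
    (hQ : Contains (μ.submatrix i.succAbove j.succAbove) Q) : Q.det = 0 := by
  choose B hB using fun a b => (hμ a b).2.1
  let A : Matrix (Fin (p + 1)) (Fin (p + 1)) ℝ :=
    Matrix.of fun a b => i.insertNth (α := fun _ => ℝ) (B a b)
      (fun a' => j.insertNth (α := fun _ => ℝ) (B a b) (fun b' => Q a' b') b) a
  have hA : ∀ x : ℝ, Contains μ (A + x • Matrix.single i j (1 : ℝ)) := by
    intro x a b
    by_cases he : a = i ∧ b = j
    · rw [he.1, he.2, hij]
      exact Set.mem_univ _
    rw [add_smul_single_apply_of_ne _ _ he]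
    simp only [A, Matrix.of_apply]
    induction a using Fin.succAboveCases i with
    | x => simpa using hB _ _
    | p a =>
      induction b using Fin.succAboveCases j with
      | x => simpa using hB _ _
      | p b => simpa using hQ a b
  have hsub : A.submatrix i.succAbove j.succAbove = Q := by
    ext a b
    simp [A]
  by_contra hne
  have hadj : A.adjugate j i ≠ 0 := by
    rw [Matrix.adjugate_fin_succ_eq_det_submatrix, hsub]
    exact mul_ne_zero (by simp) hne
  refine h _ (hA (-A.det / A.adjugate j i)) ?_
  rw [det_add_smul_single]
  field_simp
  ring

theorem det_eq_det_of_forall_submatrix {p : ℕ}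
    {μ : Matrix (Fin (p + 1)) (Fin (p + 1)) (Set ℝ)}
    (h : ∀ i j, μ i j = Set.univ → ∀ Q : Matrix (Fin p) (Fin p) ℝ,
      Contains (μ.submatrix i.succAbove j.succAbove) Q → Q.det = 0)
    {A : Matrix (Fin (p + 1)) (Fin (p + 1)) ℝ} (hA : Contains μ A) :
    (Matrix.of fun i j => if μ i j = Set.univ then 0 else A i j).det = A.det := by
  have key : ∀ F : Finset (Fin (p + 1) × Fin (p + 1)),
      (Matrix.of fun i j => if μ i j = Set.univ ∧ (i, j) ∈ F then 0 else A i j).det = A.det := by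
    intro F
    induction F using Finset.induction_on with
    | empty =>
      congr 1
      ext i j
      simp
    | insert e F he ih =>
      obtain ⟨i, j⟩ := e
      by_cases hij : μ i j = Set.univ
      swap
      · rw [← ih]
        congr 1
        ext a b
        by_cases hab : a = i ∧ b = j
        · simp [hab.1, hab.2, hij]
        · simp [hab]
      set A' : Matrix (Fin (p + 1)) (Fin (p + 1)) ℝ :=
        Matrix.of fun i j => if μ i j = Set.univ ∧ (i, j) ∈ F then 0 else A i j with hA'
      have hcont : Contains μ A' := by
        intro a b
        rw [hA', Matrix.of_apply]
        split_ifs with hab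
        · rw [hab.1]
          exact Set.mem_univ _
        · exact hA a b
      have hadj : A'.adjugate j i = 0 := by
        rw [Matrix.adjugate_fin_succ_eq_det_submatrix,
          h i j hij (A'.submatrix i.succAbove j.succAbove) fun a b => hcont _ _, mul_zero]
      have hstep : (A' + (-A i j) • Matrix.single i j (1 : ℝ)).det = A'.det := by
        rw [det_add_smul_single, hadj, mul_zero, add_zero]
      rw [← ih, ← hstep]
      congr 1
      ext a b
      by_cases hab : a = i ∧ b = j
      · rw [hab.1, hab.2, add_smul_single_apply_same]
        simp [hA', hij, he]
      · rw [add_smul_single_apply_of_ne _ _ hab]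
        simp [hA', hab]
  simpa using key Finset.univ

theorem mul_det_pos {p : ℕ} {μ : Matrix (Fin p) (Fin p) (Set ℝ)} (hμ : GCIM μ)
    (h : ∀ A, Contains μ A → A.det ≠ 0) {A B : Matrix (Fin p) (Fin p) ℝ} (hA : Contains μ A)
    (hB : Contains μ B) : 0 < A.det * B.det := by
  have hconn : IsPreconnected {A : Matrix (Fin p) (Fin p) ℝ | Contains μ A} := by
    have := isPreconnected_univ_pi fun i => isPreconnected_univ_pi fun j => (hμ i j).2.2
    rwa [show {A : Matrix (Fin p) (Fin p) ℝ | Contains μ A} =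
      Set.univ.pi fun i => Set.univ.pi fun j => μ i j from
      Set.ext fun A => ⟨fun h i _ j _ => h i j, fun h i j => h i trivial j trivial⟩]
  have hcont : ContinuousOn Matrix.det {A : Matrix (Fin p) (Fin p) ℝ | Contains μ A} :=
    continuous_id.matrix_det.continuousOn
  by_contra hneg
  have hlt := lt_of_le_of_ne (not_lt.1 hneg) (mul_ne_zero (h A hA) (h B hB))
  obtain ⟨h1, h2⟩ | ⟨h1, h2⟩ := mul_neg_iff.1 hlt
  · obtain ⟨C, hC, hC0⟩ := hconn.intermediate_value hB hA hcont ⟨h2.le, h1.le⟩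
    exact h C hC hC0
  · obtain ⟨C, hC, hC0⟩ := hconn.intermediate_value hA hB hcont ⟨h1.le, h2.le⟩
    exact h C hC hC0

/-- The sign of the unbounded direction of the half-bounded entry `S`. -/
noncomputable def dirSign (S : Set ℝ) : ℝ := if IsRightB S then -1 else 1

theorem prod_dirSign {s : ℕ} (S : Fin s → Set ℝ) :
    ∏ t, dirSign (S t) = (-1) ^ (Finset.univ.filter fun t => IsRightB (S t)).card := by
  simp [dirSign, Finset.prod_ite]

theorem add_dirSign_mem {S : Set ℝ} (hS : IsLeftB S ∨ IsRightB S) {x T : ℝ} (hx : x ∈ S)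
    (hT : 0 ≤ T) : x + T * dirSign S ∈ S := by
  obtain ⟨a, rfl⟩ | ⟨a, rfl⟩ := hS
  · rw [dirSign, if_neg (not_isRightB_Ici a)]
    rw [Set.mem_Ici] at hx ⊢
    linarith
  · rw [dirSign, if_pos ⟨a, rfl⟩]
    rw [Set.mem_Iic] at hx ⊢
    linarith

theorem contains_add_positionMatrix {s n : ℕ} {μ : Matrix (Fin n) (Fin n) (Set ℝ)}
    {B : Matrix (Fin n) (Fin n) ℝ} (hB : Contains μ B) {r c : Fin s → Fin n}
    (hr : Function.Injective r) (h : ∀ t, IsLeftB (μ (r t) (c t)) ∨ IsRightB (μ (r t) (c t)))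
    {T : ℝ} (hT : 0 ≤ T) :
    Contains μ (B + T • positionMatrix r c fun t => dirSign (μ (r t) (c t))) := by
  intro a b
  rw [Matrix.add_apply, Matrix.smul_apply, smul_eq_mul]
  by_cases ha : ∃ t, r t = a
  · obtain ⟨t, rfl⟩ := ha
    rw [positionMatrix_apply _ _ hr]
    by_cases hb : b = c t
    · rw [hb, Pi.single_eq_same]
      exact add_dirSign_mem (h t) (hB _ _) hT
    · rw [Pi.single_eq_of_ne hb, mul_zero, add_zero]
      exact hB _ _
  · rw [positionMatrix_apply_of_not_exists _ _ ha, Pi.zero_apply, mul_zero, add_zero]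
    exact hB _ _

theorem sign_mul_gdet {s n : ℕ} (μ : Matrix (Fin n) (Fin n) (Set ℝ))
    (B : Matrix (Fin n) (Fin n) ℝ) {r c : Fin s → Fin n} (hr : Function.Injective r)
    (hc : Function.Injective c) (d : ℝ) :
    (-1 : ℝ) ^ ((∑ t : Fin s,
        (((r t : ℕ) - (Finset.univ.filter fun u => u < t ∧ r u < r t).card) +
          ((c t : ℕ) - (Finset.univ.filter fun u => u < t ∧ c u < c t).card))) +
        (Finset.univ.filter fun t => IsRightB (μ (r t) (c t))).card) * d *
      gdet (Matrix.of fun (a : {a : Fin n // ∀ t, r t ≠ a}) (b : {b : Fin n // ∀ t, c t ≠ b}) =>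
        B a.1 b.1) =
    d * ((∏ t, dirSign (μ (r t) (c t))) * (unitRows B r c).det) := by
  rw [det_unitRows_eq_gdet B hr hc, prod_dirSign, Finset.sum_add_distrib, pow_add]
  unfold laplaceExp
  ring

theorem halfBounded_of_not_isBddEntry_tildeM {I J : Type*} {μ : Matrix I J (Set ℝ)} (hμ : GCIM μ) {i : I} {j : J}
    (h : ¬ IsBddEntry (tildeM μ i j)) :
    (IsLeftB (μ i j) ∨ IsRightB (μ i j)) ∧ tildeM μ i j = μ i j := by
  obtain ⟨a, b, hab, h1, -⟩ | ⟨a, h1, h2⟩ | ⟨a, h1, h2⟩ := tildeM_cases hμ i j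
  · exact absurd (h1 ▸ isBddEntry_Icc hab) h
  · exact ⟨Or.inl ⟨a, h2⟩, h1.trans h2.symm⟩
  · exact ⟨Or.inr ⟨a, h2⟩, h1.trans h2.symm⟩

theorem sub_pick_eq {S : Set ℝ} (hS : IsLeftB S ∨ IsRightB S) {x : ℝ} (hx : x ∈ S) :
    x - pick S = |x - pick S| * dirSign S := by
  obtain ⟨a, rfl⟩ | ⟨a, rfl⟩ := hS
  · rw [dirSign, if_neg (not_isRightB_Ici a), pick_Ici, abs_of_nonneg (sub_nonneg.2 hx), mul_one]
  · rw [dirSign, if_pos ⟨a, rfl⟩, pick_Iic, abs_of_nonpos (sub_nonpos.2 hx)]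
    ring

/-- Sufficiency of the sign conditions for matrices without entry `(-∞, +∞)`. -/
theorem det_ne_zero_of_sign_conditions {p : ℕ}
    {μ : Matrix (Fin (p + 1)) (Fin (p + 1)) (Set ℝ)} (hμ : GCIM μ) {d : ℝ}
    (h2 : ∀ γ, IsVertex (barM (tildeM μ)) γ → EvenTypeG (barM (tildeM μ)) γ →
      0 < d * (Matrix.of fun i j => pick (γ i j)).det)
    (h3 : ∀ γ, IsVertex (tildeM μ) γ → EvenTypeG (tildeM μ) γ →
      ∀ s : ℕ, 1 ≤ s → ∀ r c : Fin s → Fin (p + 1),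
        Function.Injective r → Function.Injective c →
        (∀ t, IsLeftB (μ (r t) (c t)) ∨ IsRightB (μ (r t) (c t))) →
        0 ≤ d * ((∏ t, dirSign (μ (r t) (c t))) *
          (unitRows (Matrix.of fun i j => pick (γ i j)) r c).det))
    {A : Matrix (Fin (p + 1)) (Fin (p + 1)) ℝ} (hA : Contains (tildeM μ) A) : A.det ≠ 0 := by
  let lo : Matrix (Fin (p + 1)) (Fin (p + 1)) ℝ := Matrix.of fun i j =>
    if IsBddEntry (tildeM μ i j) then sInf (tildeM μ i j) else A i j
  let hi : Matrix (Fin (p + 1)) (Fin (p + 1)) ℝ := Matrix.of fun i j =>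
    if IsBddEntry (tildeM μ i j) then sSup (tildeM μ i j) else A i j
  refine det_ne_zero_of_corners d (lo := lo) (hi := hi) (fun i j => ?_) (fun i j => ?_)
    fun y z => ?_
  · simp only [lo, Matrix.of_apply]
    split_ifs with hb
    · obtain ⟨a, b, -, h⟩ := hb
      exact csInf_le (h ▸ bddBelow_Icc) (hA i j)
    · exact le_rfl
  · simp only [hi, Matrix.of_apply]
    split_ifs with hb
    · obtain ⟨a, b, -, h⟩ := hb
      exact le_csSup (h ▸ bddAbove_Icc) (hA i j)
    · exact le_rfl
  set V : Matrix (Fin (p + 1)) (Fin (p + 1)) ℝ :=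
    Matrix.of fun i j => if y i = z j then lo i j else hi i j with hV
  let B : Matrix (Fin (p + 1)) (Fin (p + 1)) ℝ :=
    Matrix.of fun i j => pick (cornerM (tildeM μ) y z i j)
  have hB : 0 < d * B.det := by
    have := h2 _ (isVertex_cornerM (barM (tildeM μ)) y z) (evenTypeG_cornerM _ y z)
    simpa only [pick_cornerM_barM hμ] using this
  have hbdd : ∀ i j, IsBddEntry (tildeM μ i j) → V i j = B i j := by
    intro i j hb
    simp [V, B, lo, hi, hb, cornerM, pick_singleton]
  have hhalf : ∀ i j, ¬ IsBddEntry (tildeM μ i j) →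
      (V - B) i j = |(V - B) i j| * dirSign (μ i j) := by
    intro i j hb
    obtain ⟨hlr, heq⟩ := halfBounded_of_not_isBddEntry_tildeM hμ hb
    have hVB : (V - B) i j = A i j - pick (μ i j) := by
      simp only [V, B, lo, hi, hb, cornerM, Matrix.sub_apply, Matrix.of_apply, if_false, ite_self]
      rw [heq]
    rw [hVB]
    exact sub_pick_eq hlr (heq ▸ hA i j)
  have hle := mul_det_le_mul_det_add B (V - B) d fun s hs r c hr hc hrc => by
    have hnb : ∀ t, ¬ IsBddEntry (tildeM μ (r t) (c t)) := fun t hb =>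
      hrc t (by rw [Matrix.sub_apply, hbdd _ _ hb, sub_self])
    rw [Finset.prod_congr rfl fun t _ => hhalf _ _ (hnb t), Finset.prod_mul_distrib, mul_assoc,
      mul_left_comm]
    exact mul_nonneg (Finset.prod_nonneg fun t _ => abs_nonneg _)
      (h3 _ (isVertex_cornerM _ y z) (evenTypeG_cornerM _ y z) s hs r c hr hc
        fun t => (halfBounded_of_not_isBddEntry_tildeM hμ (hnb t)).1)
  rw [add_sub_cancel] at hle
  exact hB.trans_le hle

/-- **Characterization of full-rank square general closed interval matrices**
(generalization of Rohn's theorem).  A `(p+1) × (p+1)` general closed interval matrix `μ`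
is full-rank iff:
(1) for every entry `(i,j)` with `μ i j = (-∞,+∞)`, the matrix `μ` with row `i` and column
`j` deleted has no totally nonconstant pg-diagonal of maximal length, and the
complementary matrix of each of its totally nonconstant pg-diagonals of smaller length has
`det^c = 0`;
(2) every vertex matrix of even type of `(μ̃)̄` has determinant of the same sign as
`det (μ̃)̄ₗ`;
(3) for every vertex matrix `γ` of `μ̃` of even type and all positions
`(i₁,j₁), …, (i_s,j_s)` (`s ≥ 1`, rows distinct, columns distinct, `0`-based; the parity
of the sign exponent agrees with the `1`-based one of the paper) at which `μ` is
half-bounded, `(-1) ^ (∑ₜ (ĩ_t + j̃_t) + χ) · det (μ̃)̄ₗ · det γ̄_{rows/cols deleted} ≥ 0`,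
where `ĩ_t = i_t - #{u < t | i_u < i_t}`, `j̃_t = j_t - #{u < t | j_u < j_t}` and `χ` is
the number of right-bounded entries among the selected ones. -/
theorem fullRank_iff_general (p : ℕ) (μ : Matrix (Fin (p + 1)) (Fin (p + 1)) (Set ℝ))
    (hμ : GCIM μ) :
    (∀ A : Matrix (Fin (p + 1)) (Fin (p + 1)) ℝ, Contains μ A → A.det ≠ 0) ↔
    ((∀ i j, μ i j = Set.univ →
        ((¬ ∃ r c : Fin p → Fin p, Function.Injective r ∧ Function.Injective c ∧
            ∀ t, ¬ IsConst (μ.submatrix i.succAbove j.succAbove (r t) (c t))) ∧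
         (∀ k : ℕ, k < p → ∀ r c : Fin k → Fin p,
            Function.Injective r → Function.Injective c →
            (∀ t, ¬ IsConst (μ.submatrix i.succAbove j.succAbove (r t) (c t))) →
            detc (Matrix.of fun (a : {a : Fin p // ∀ t, r t ≠ a})
                (b : {b : Fin p // ∀ t, c t ≠ b}) =>
              μ.submatrix i.succAbove j.succAbove a.1 b.1) = 0))) ∧
     (∀ γ : Matrix (Fin (p + 1)) (Fin (p + 1)) (Set ℝ),
        IsVertex (barM (tildeM μ)) γ → EvenTypeG (barM (tildeM μ)) γ →
        0 < (Matrix.of fun i j => pick (γ i j)).det *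
            (Matrix.of fun i j => pick (tildeM μ i j)).det) ∧
     (∀ γ : Matrix (Fin (p + 1)) (Fin (p + 1)) (Set ℝ),
        IsVertex (tildeM μ) γ → EvenTypeG (tildeM μ) γ →
        ∀ s : ℕ, 1 ≤ s → ∀ r c : Fin s → Fin (p + 1),
          Function.Injective r → Function.Injective c →
          (∀ t, IsLeftB (μ (r t) (c t)) ∨ IsRightB (μ (r t) (c t))) →
          0 ≤ (-1 : ℝ) ^
                ((∑ t : Fin s,
                  (((r t : ℕ) - (Finset.univ.filter fun u => u < t ∧ r u < r t).card) +
                   ((c t : ℕ) - (Finset.univ.filter fun u => u < t ∧ c u < c t).card))) +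
                 (Finset.univ.filter fun t => IsRightB (μ (r t) (c t))).card) *
              (Matrix.of fun i j => pick (tildeM μ i j)).det *
              gdet (Matrix.of fun (a : {a : Fin (p + 1) // ∀ t, r t ≠ a})
                  (b : {b : Fin (p + 1) // ∀ t, c t ≠ b}) => pick (γ a.1 b.1)))) := by
  simp only [detc_conditions_iff]
  have hsub : ∀ i j : Fin (p + 1), GCIM (μ.submatrix i.succAbove j.succAbove) :=
    fun i j a b => hμ _ _
  constructor
  · intro h
    refine ⟨fun i j hij k r c hr _ hrc => unitRows_det_eq_zero (hsub i j)
      (fun Q hQ => det_submatrix_eq_zero hμ h hij hQ) hr hrc, fun γ hγ _ => ?_,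
      fun γ hγ _ s _ r c hr hc hrc => ?_⟩
    · exact mul_det_pos hμ h (contains_pick_of_isVertex_barM hμ hγ) (contains_pick_tildeM hμ)
    · refine (nonneg_det_unitRows (Matrix.of fun i j => pick (γ i j)) c hr _ _ fun T hT => ?_).trans
        (sign_mul_gdet μ _ hr hc _).ge
      exact (mul_det_pos hμ h (contains_pick_tildeM hμ) (contains_add_positionMatrix
        (contains_pick_of_isVertex hμ hγ) hr hrc hT.le)).le
  · rintro ⟨h1, h2, h3⟩ A hA
    rw [← det_eq_det_of_forall_submatrix
      (fun i j hij Q hQ => det_eq_zero_of_unitRows (h1 i j hij) hQ) hA]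
    refine det_ne_zero_of_sign_conditions hμ
      (d := (Matrix.of fun i j => pick (tildeM μ i j)).det) (fun γ hγ he => ?_)
      (fun γ hγ he s hs r c hr hc hrc => ?_) fun i j => ?_
    · rw [mul_comm]
      exact h2 γ hγ he
    · exact (h3 γ hγ he s hs r c hr hc hrc).trans
        (sign_mul_gdet μ (Matrix.of fun i j => pick (γ i j)) hr hc _).le
    · rw [Matrix.of_apply, tildeM, Matrix.of_apply]
      split_ifs
      exacts [rfl, hA i j]
end

section
/- Let μ be a p×p general interval matrix (entries are connected nonempty subsets of ℝ) that is full-rank, i.e., every real matrix contained in μ has nonzero determinant. Then the determinants of all real matrices contained in μ have the same sign: for any real matrices A, B ∈ μ, det(A) · det(B) > 0. -/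
theorem isPreconnected_setOf_contains {I J : Type*} {μ : Matrix I J (Set ℝ)}
    (hμ : ∀ i j, IsPreconnected (μ i j)) :
    IsPreconnected {A : Matrix I J ℝ | Contains μ A} := by
  have h : {A : Matrix I J ℝ | Contains μ A} = Set.univ.pi fun i => Set.univ.pi (μ i) := by
    ext A
    exact ⟨fun hA i _ j _ => hA i j, fun hA i j => hA i trivial j trivial⟩
  rw [h]
  exact isPreconnected_univ_pi fun i => isPreconnected_univ_pi (hμ i)

/-- **Constant sign of the determinant on a full-rank general interval matrix.**
If `μ` is a `p × p` general interval matrix (all entries connected and nonempty) such that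
every real matrix contained in `μ` has nonzero determinant, then the determinants of all
real matrices contained in `μ` have the same sign. -/
theorem det_same_sign_of_fullRank (p : ℕ) (μ : Matrix (Fin p) (Fin p) (Set ℝ))
    (hμ : ∀ i j, (μ i j).Nonempty ∧ IsPreconnected (μ i j))
    (hfr : ∀ A : Matrix (Fin p) (Fin p) ℝ, Contains μ A → A.det ≠ 0) :
    ∀ A B : Matrix (Fin p) (Fin p) ℝ, Contains μ A → Contains μ B →
      0 < A.det * B.det := by
  intro A B hA hB
  have hconn := ((isPreconnected_setOf_contains fun i j => (hμ i j).2).image Matrix.det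
    continuous_id.matrix_det.continuousOn).ordConnected
  have hdetA := Set.mem_image_of_mem Matrix.det (show A ∈ {A | Contains μ A} from hA)
  have hdetB := Set.mem_image_of_mem Matrix.det (show B ∈ {A | Contains μ A} from hB)
  by_contra! hle
  have hzero : (0 : ℝ) ∈ Matrix.det '' {A | Contains μ A} := by
    rcases mul_nonpos_iff.mp hle with ⟨h₁, h₂⟩ | ⟨h₁, h₂⟩
    · exact hconn.out hdetB hdetA ⟨h₂, h₁⟩
    · exact hconn.out hdetA hdetB ⟨h₁, h₂⟩
  obtain ⟨C, hC, hdet⟩ := hzero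
  exact hfr C hC hdet
end
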